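/- arXiv:math/0504040 — 4 statements merged into one kernel-verified Lean document; each statement's English description precedes it below -/
import Mathlib

section
/- A polynomial h ∈ ℝ[x,y] is the hessian determinant of some polynomial f ∈ ℝ[x,y] (i.e., h = f_{xx} f_{yy} − f_{xy}²) if and only if there exist polynomials p, q, r ∈ ℝ[x,y] such that ∂p/∂y = ∂q/∂x, ∂q/∂y = ∂r/∂x, and h = p·r − q². -/
open MvPolynomial

/-- The hessian determinant of a polynomial in two variables over the reals:
`Hess f = f_xx * f_yy - f_xy ^ 2` (with formal partial derivatives). -/
noncomputable def Hess (f : MvPolynomial (Fin 2) ℝ) : MvPolynomial (Fin 2) ℝ :=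
  pderiv 0 (pderiv 0 f) * pderiv 1 (pderiv 1 f) - (pderiv 0 (pderiv 1 f)) ^ 2

namespace MvPolynomial

variable {σ K : Type*} [Field K]

lemma pderiv_pderiv_comm {R : Type*} [CommSemiring R] (i j : σ) (p : MvPolynomial σ R) :
    pderiv i (pderiv j p) = pderiv j (pderiv i p) := by
  obtain rfl | hij := eq_or_ne i j
  · rfl
  ext m
  simp only [coeff_pderiv, Finsupp.add_apply, Finsupp.single_eq_of_ne hij,
    Finsupp.single_eq_of_ne hij.symm, add_zero]
  rw [add_right_comm]
  ring

/-- The formal antiderivative with respect to the variable `i`, vanishing where `X i` does. -/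
noncomputable def antideriv (i : σ) : MvPolynomial σ K →ₗ[K] MvPolynomial σ K :=
  (basisMonomials σ K).constr K fun m => monomial (m + Finsupp.single i 1) ((m i + 1 : K)⁻¹)

lemma antideriv_monomial (i : σ) (m : σ →₀ ℕ) (a : K) :
    antideriv i (monomial m a) = monomial (m + Finsupp.single i 1) (a * (m i + 1 : K)⁻¹) := by
  have h := (basisMonomials σ K).constr_basis K
    (fun m => monomial (m + Finsupp.single i 1) ((m i + 1 : K)⁻¹)) m
  rw [coe_basisMonomials] at h
  rw [← mul_one a, ← smul_eq_mul, ← smul_monomial, map_smul, antideriv, h, smul_monomial]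
  simp

lemma pderiv_antideriv [CharZero K] (i : σ) (p : MvPolynomial σ K) :
    pderiv i (antideriv i p) = p := by
  induction p using MvPolynomial.induction_on' with
  | monomial m a =>
    have : (m i + 1 : K) ≠ 0 := Nat.cast_add_one_ne_zero _
    simp [antideriv_monomial, pderiv_monomial, this]
  | add p q hp hq => rw [map_add, map_add, hp, hq]

lemma pderiv_antideriv_of_ne {i j : σ} (hij : i ≠ j) (p : MvPolynomial σ K) :
    pderiv j (antideriv i p) = antideriv i (pderiv j p) := by
  induction p using MvPolynomial.induction_on' with
  | monomial m a =>
    simp only [antideriv_monomial, pderiv_monomial, Finsupp.add_apply, Finsupp.tsub_apply,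
      Finsupp.single_eq_of_ne hij, Finsupp.single_eq_of_ne hij.symm, add_zero, tsub_zero]
    obtain hm | hm := Nat.eq_zero_or_pos (m j)
    · simp [hm]
    · rw [tsub_add_eq_add_tsub (Finsupp.single_le_iff.mpr hm), mul_right_comm]
  | add p q hp hq => simp only [map_add, hp, hq]

/-- The Poincaré lemma for closed polynomial 1-forms in two variables. -/
lemma exists_pderiv_eq_of_pderiv_eq [CharZero K] {i j : σ} (hij : i ≠ j)
    {p q : MvPolynomial σ K} (h : pderiv j p = pderiv i q) :
    ∃ u, pderiv i u = p ∧ pderiv j u = q := by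
  refine ⟨antideriv i p + antideriv j (q - pderiv j (antideriv i p)), ?_, ?_⟩
  · rw [map_add, pderiv_antideriv, pderiv_antideriv_of_ne hij.symm, map_sub,
      pderiv_pderiv_comm, pderiv_antideriv, h, sub_self, map_zero, add_zero]
  · rw [map_add, pderiv_antideriv, add_sub_cancel]

end MvPolynomial

/-- A polynomial `h` is a hessian iff there exist `p, q, r` with
`p_y = q_x`, `q_y = r_x`, and `h = p * r - q ^ 2`. -/
theorem hessian_iff (h : MvPolynomial (Fin 2) ℝ) :
    (∃ f : MvPolynomial (Fin 2) ℝ, h = Hess f) ↔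
      ∃ p q r : MvPolynomial (Fin 2) ℝ,
        pderiv 1 p = pderiv 0 q ∧ pderiv 1 q = pderiv 0 r ∧ h = p * r - q ^ 2 := by
  constructor
  · rintro ⟨f, rfl⟩
    exact ⟨pderiv 0 (pderiv 0 f), pderiv 0 (pderiv 1 f), pderiv 1 (pderiv 1 f),
      by rw [pderiv_pderiv_comm 1 0, pderiv_pderiv_comm 1 0], pderiv_pderiv_comm 1 0 _, rfl⟩
  · rintro ⟨p, q, r, hpq, hqr, rfl⟩
    obtain ⟨u, rfl, hu⟩ := exists_pderiv_eq_of_pderiv_eq zero_ne_one hpq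
    obtain ⟨v, hv, rfl⟩ := exists_pderiv_eq_of_pderiv_eq zero_ne_one hqr
    obtain ⟨f, rfl, rfl⟩ := exists_pderiv_eq_of_pderiv_eq zero_ne_one (hu.trans hv.symm)
    exact ⟨f, by rw [Hess, hv]⟩
end

section
/- There exists a real polynomial f of total degree 4 in two variables such that the hessian curve Z = {(x,y) ∈ ℝ² : Hess(f)(x,y) = 0} is a compact subset of ℝ², the gradient of Hess(f) is nonzero at every point of Z (so the curve is smooth), and Z has exactly 4 connected components. -/
open MvPolynomial

/-- The set of connected components of a set `Z ⊆ ℝ × ℝ` (with its subspace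
topology), viewed as subsets of `ℝ × ℝ`. -/
def components (Z : Set (ℝ × ℝ)) : Set (Set (ℝ × ℝ)) :=
  {C | ∃ p ∈ Z, C = connectedComponentIn Z p}

/-- If `Z` is a finite disjoint union of closed connected sets, these are its components. -/
theorem components_iUnion {ι : Type*} [Finite ι] {S : ι → Set (ℝ × ℝ)}
    (hclosed : ∀ i, IsClosed (S i)) (hconn : ∀ i, IsConnected (S i))
    (hdisj : Pairwise fun i j => Disjoint (S i) (S j)) :
    components (⋃ i, S i) = Set.range S := by
  have key : ∀ i, ∀ p ∈ S i, connectedComponentIn (⋃ i, S i) p = S i := by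
    intro i p hp
    have hpZ : p ∈ ⋃ i, S i := Set.mem_iUnion_of_mem i hp
    refine Set.Subset.antisymm ?_
      ((hconn i).isPreconnected.subset_connectedComponentIn hp (Set.subset_iUnion S i))
    have hrest : IsClosed (⋃ j : {j // j ≠ i}, S j) := isClosed_iUnion_of_finite fun j => hclosed j
    have hinter : S i ∩ (⋃ j : {j // j ≠ i}, S j) = ∅ := by
      rw [← Set.disjoint_iff_inter_eq_empty, Set.disjoint_iUnion_right]
      exact fun j => hdisj j.2.symm
    have hcover : connectedComponentIn (⋃ i, S i) p ⊆ S i ∪ ⋃ j : {j // j ≠ i}, S j := by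
      intro z hz
      obtain ⟨j, hj⟩ := Set.mem_iUnion.1 (connectedComponentIn_subset _ _ hz)
      by_cases hji : j = i
      · exact Or.inl (hji ▸ hj)
      · exact Or.inr (Set.mem_iUnion.2 ⟨⟨j, hji⟩, hj⟩)
    rcases isPreconnected_iff_subset_of_disjoint_closed.1
      (isPreconnected_connectedComponentIn (x := p) (F := ⋃ i, S i)) _ _ (hclosed i) hrest hcover
      (by rw [hinter, Set.inter_empty]) with h | h
    · exact h
    · have : p ∈ S i ∩ ⋃ j : {j // j ≠ i}, S j := ⟨hp, h (mem_connectedComponentIn hpZ)⟩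
      simp [hinter] at this
  ext C
  constructor
  · rintro ⟨p, hp, rfl⟩
    obtain ⟨i, hi⟩ := Set.mem_iUnion.1 hp
    exact ⟨i, (key i p hi).symm⟩
  · rintro ⟨i, rfl⟩
    obtain ⟨p, hp⟩ := (hconn i).nonempty
    exact ⟨p, Set.mem_iUnion_of_mem i hp, (key i p hp).symm⟩

theorem ncard_components_iUnion {ι : Type*} [Finite ι] {S : ι → Set (ℝ × ℝ)}
    (hclosed : ∀ i, IsClosed (S i)) (hconn : ∀ i, IsConnected (S i))
    (hdisj : Pairwise fun i j => Disjoint (S i) (S j)) :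
    (components (⋃ i, S i)).ncard = Nat.card ι := by
  rw [components_iUnion hclosed hconn hdisj, ← Set.image_univ, Set.ncard_image_of_injective,
    Set.ncard_univ]
  intro i j hij
  by_contra h
  have := hdisj h
  simp only [hij, disjoint_self, Set.bot_eq_empty] at this
  exact (hconn j).nonempty.ne_empty this

/-- The part of the curve `(2 y ^ 2 + p x) ^ 2 = d x` over `[a, b]` on which `y` has the sign
of `σ`. -/
def oval (p d : ℝ → ℝ) (a b σ : ℝ) : Set (ℝ × ℝ) :=
  {z | z.1 ∈ Set.Icc a b ∧ 0 < σ * z.2 ∧ (2 * z.2 ^ 2 + p z.1) ^ 2 = d z.1}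

theorem oval_eq_union {p d : ℝ → ℝ} {a b σ : ℝ} (hσ : σ ^ 2 = 1)
    (hd : ∀ x ∈ Set.Icc a b, 0 ≤ d x) (hp : ∀ x ∈ Set.Icc a b, √(d x) < -p x) :
    oval p d a b σ =
      (fun x => (x, σ * √((-p x + √(d x)) / 2))) '' Set.Icc a b ∪
      (fun x => (x, σ * √((-p x - √(d x)) / 2))) '' Set.Icc a b := by
  have hσσ : σ * σ = 1 := by rw [← hσ, sq]
  have hsolve : ∀ y t : ℝ, 0 < σ * y → y ^ 2 = t → σ * √t = y := by
    intro y t hy ht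
    have : √t = σ * y := by
      rw [← ht, show y ^ 2 = (σ * y) ^ 2 by rw [mul_pow, hσ, one_mul], Real.sqrt_sq hy.le]
    rw [this, ← mul_assoc, hσσ, one_mul]
  ext ⟨x, y⟩
  constructor
  · rintro ⟨hx, hy, h⟩
    simp only at hx hy h
    have hs := Real.sq_sqrt (hd x hx)
    have : (2 * y ^ 2 + p x - √(d x)) * (2 * y ^ 2 + p x + √(d x)) = 0 := by
      linear_combination h - hs
    rcases mul_eq_zero.1 this with h' | h'
    · exact Or.inl ⟨x, hx, Prod.ext rfl (hsolve y _ hy (by linarith))⟩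
    · exact Or.inr ⟨x, hx, Prod.ext rfl (hsolve y _ hy (by linarith))⟩
  · have aux : ∀ s, s ^ 2 = d x → x ∈ Set.Icc a b → 0 < -p x + s →
        (x, σ * √((-p x + s) / 2)) ∈ oval p d a b σ := by
      intro s hs hx hpos
      refine ⟨hx, ?_, ?_⟩
      · simp only [← mul_assoc, hσσ, one_mul]
        exact Real.sqrt_pos.2 (by linarith)
      · simp only [mul_pow, hσ, one_mul]
        rw [Real.sq_sqrt (by linarith), ← hs]
        ring
    rintro (⟨x', hx, h⟩ | ⟨x', hx, h⟩) <;> obtain ⟨rfl, rfl⟩ := Prod.mk.inj h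
    · exact aux _ (Real.sq_sqrt (hd x' hx)) hx (by linarith [hp x' hx, Real.sqrt_nonneg (d x')])
    · have := aux (-√(d x')) (by rw [neg_sq, Real.sq_sqrt (hd x' hx)]) hx
        (by linarith [hp x' hx])
      simpa only [← sub_eq_add_neg] using this

theorem isCompact_oval {p d : ℝ → ℝ} (hpc : Continuous p) (hdc : Continuous d) {a b σ : ℝ}
    (hσ : σ ^ 2 = 1) (hd : ∀ x ∈ Set.Icc a b, 0 ≤ d x)
    (hp : ∀ x ∈ Set.Icc a b, √(d x) < -p x) : IsCompact (oval p d a b σ) := by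
  rw [oval_eq_union hσ hd hp]
  exact (isCompact_Icc.image (by fun_prop)).union (isCompact_Icc.image (by fun_prop))

theorem isConnected_oval {p d : ℝ → ℝ} (hpc : Continuous p) (hdc : Continuous d) {a b σ : ℝ}
    (hσ : σ ^ 2 = 1) (hab : a ≤ b) (hd : ∀ x ∈ Set.Icc a b, 0 ≤ d x)
    (hp : ∀ x ∈ Set.Icc a b, √(d x) < -p x) (ha : d a = 0) : IsConnected (oval p d a b σ) := by
  rw [oval_eq_union hσ hd hp]
  have hmem := Set.left_mem_Icc.2 hab
  refine IsConnected.union ⟨(a, σ * √(-p a / 2)), ⟨a, hmem, by simp [ha]⟩,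
    ⟨a, hmem, by simp [ha]⟩⟩ ?_ ?_
  all_goals exact (isConnected_Icc hab).image _ (by fun_prop)

/-- A quartic with the sign pattern `-, +, -, +, -` splits into linear factors with roots
in the gaps. -/
theorem exists_factorization_of_signs {c₀ c₁ c₂ c₃ c₄ s₀ s₁ s₂ s₃ s₄ : ℝ} {d : ℝ → ℝ}
    (hd : ∀ x, d x = c₄ * x ^ 4 + c₃ * x ^ 3 + c₂ * x ^ 2 + c₁ * x + c₀)
    (h01 : s₀ ≤ s₁) (h12 : s₁ ≤ s₂) (h23 : s₂ ≤ s₃) (h34 : s₃ ≤ s₄)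
    (h0 : d s₀ < 0) (h1 : 0 < d s₁) (h2 : d s₂ < 0) (h3 : 0 < d s₃) (h4 : d s₄ < 0) :
    ∃ r₁ r₂ r₃ r₄, r₁ < r₂ ∧ r₂ < r₃ ∧ r₃ < r₄ ∧
      ∀ x, d x = c₄ * ((x - r₁) * (x - r₂) * (x - r₃) * (x - r₄)) := by
  have hc : Continuous d := by rw [funext hd]; fun_prop
  obtain ⟨r₁, ⟨-, hr1⟩, e1⟩ := intermediate_value_Ioo h01 hc.continuousOn ⟨h0, h1⟩
  obtain ⟨r₂, ⟨hr2, hr2'⟩, e2⟩ := intermediate_value_Ioo' h12 hc.continuousOn ⟨h2, h1⟩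
  obtain ⟨r₃, ⟨hr3, hr3'⟩, e3⟩ := intermediate_value_Ioo h23 hc.continuousOn ⟨h2, h3⟩
  obtain ⟨r₄, ⟨hr4, -⟩, e4⟩ := intermediate_value_Ioo' h34 hc.continuousOn ⟨h4, h3⟩
  have l12 : r₁ < r₂ := by linarith
  have l23 : r₂ < r₃ := by linarith
  have l34 : r₃ < r₄ := by linarith
  refine ⟨r₁, r₂, r₃, r₄, l12, l23, l34, fun x => ?_⟩
  rw [hd] at e1 e2 e3 e4 ⊢
  have a12 : c₄ * (r₁ ^ 3 + r₁ ^ 2 * r₂ + r₁ * r₂ ^ 2 + r₂ ^ 3) + c₃ * (r₁ ^ 2 + r₁ * r₂ + r₂ ^ 2) +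
      c₂ * (r₁ + r₂) + c₁ = 0 :=
    (mul_eq_zero.1 (by linear_combination e2 - e1)).resolve_left (sub_pos.2 l12).ne'
  have a23 : c₄ * (r₂ ^ 3 + r₂ ^ 2 * r₃ + r₂ * r₃ ^ 2 + r₃ ^ 3) + c₃ * (r₂ ^ 2 + r₂ * r₃ + r₃ ^ 2) +
      c₂ * (r₂ + r₃) + c₁ = 0 :=
    (mul_eq_zero.1 (by linear_combination e3 - e2)).resolve_left (sub_pos.2 l23).ne'
  have a34 : c₄ * (r₃ ^ 3 + r₃ ^ 2 * r₄ + r₃ * r₄ ^ 2 + r₄ ^ 3) + c₃ * (r₃ ^ 2 + r₃ * r₄ + r₄ ^ 2) +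
      c₂ * (r₃ + r₄) + c₁ = 0 :=
    (mul_eq_zero.1 (by linear_combination e4 - e3)).resolve_left (sub_pos.2 l34).ne'
  have a13 : c₄ * (r₁ ^ 2 + r₂ ^ 2 + r₃ ^ 2 + r₁ * r₂ + r₁ * r₃ + r₂ * r₃) +
      c₃ * (r₁ + r₂ + r₃) + c₂ = 0 :=
    (mul_eq_zero.1 (by linear_combination a23 - a12)).resolve_left (sub_pos.2 (l12.trans l23)).ne'
  have a24 : c₄ * (r₂ ^ 2 + r₃ ^ 2 + r₄ ^ 2 + r₂ * r₃ + r₂ * r₄ + r₃ * r₄) +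
      c₃ * (r₂ + r₃ + r₄) + c₂ = 0 :=
    (mul_eq_zero.1 (by linear_combination a34 - a23)).resolve_left (sub_pos.2 (l23.trans l34)).ne'
  have a14 : c₄ * (r₁ + r₂ + r₃ + r₄) + c₃ = 0 :=
    (mul_eq_zero.1 (by linear_combination a24 - a13)).resolve_left
      (sub_pos.2 (l12.trans (l23.trans l34))).ne'
  linear_combination e1 + (x - r₁) * a12 + (x - r₁) * (x - r₂) * a13 +
    (x - r₁) * (x - r₂) * (x - r₃) * a14

/-- A quartic whose hessian curve consists of four ovals. -/
noncomputable def ovalQuartic : MvPolynomial (Fin 2) ℝ :=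
  C 100 * X 0 ^ 4 + C 100 * X 1 ^ 4 - C 201 * (X 0 ^ 2 * X 1 ^ 2) + C 600 * X 0 ^ 2
    + C 300 * (X 0 * X 1 ^ 2) - C 3600 * X 1 ^ 2

/-- The coefficient of `y ^ 2` in the normalized hessian of `ovalQuartic`. -/
noncomputable def ovalMid (x : ℝ) : ℝ := -(79599 / 40200 * x ^ 2 + 3 / 2 * x + 552 / 67)

/-- The part of the normalized hessian of `ovalQuartic` that does not involve `y`. -/
noncomputable def ovalConst (x : ℝ) : ℝ := (x ^ 2 + 1) * (x ^ 2 - 100 / 67 * x + 1200 / 67)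

/-- The discriminant of the normalized hessian of `ovalQuartic`, as a quadratic in `y ^ 2`. -/
noncomputable def ovalDisc (x : ℝ) : ℝ := ovalMid x ^ 2 - 4 * ovalConst x

theorem ovalMid_neg (x : ℝ) : ovalMid x < 0 := by
  unfold ovalMid; nlinarith [sq_nonneg (x + 1)]

theorem ovalConst_pos (x : ℝ) : 0 < ovalConst x :=
  mul_pos (by positivity) (by nlinarith [sq_nonneg (x - 1)])

theorem ovalDisc_eq (x : ℝ) : ovalDisc x = -14239911 / 179560000 * x ^ 4 + 159599 / 13400 * x ^ 3 +
    -18299359 / 448900 * x ^ 2 + 2056 / 67 * x + -16896 / 4489 := by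
  unfold ovalDisc ovalMid ovalConst; ring

theorem hess_ovalQuartic : Hess ovalQuartic =
    (C 1200 * X 0 ^ 2 - C 402 * X 1 ^ 2 + C 1200) *
      (C 1200 * X 1 ^ 2 - C 402 * X 0 ^ 2 + C 600 * X 0 - C 7200) -
    (C 600 * X 1 - C 804 * (X 0 * X 1)) ^ 2 := by
  have h01 : pderiv (0 : Fin 2) (X 1 : MvPolynomial (Fin 2) ℝ) = 0 :=
    pderiv_X_of_ne (by decide)
  have h10 : pderiv (1 : Fin 2) (X 0 : MvPolynomial (Fin 2) ℝ) = 0 :=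
    pderiv_X_of_ne (by decide)
  simp only [Hess, ovalQuartic, map_add, map_sub, Derivation.leibniz, Derivation.leibniz_pow,
    pderiv_C, pderiv_X_self, h01, h10, smul_eq_mul, nsmul_eq_mul,
    Derivation.map_natCast, Derivation.map_one_eq_zero, map_zero]
  simp only [map_ofNat, Nat.cast_ofNat]
  ring

theorem eval_hess_ovalQuartic (x y : ℝ) : eval ![x, y] (Hess ovalQuartic) =
    -120600 * ((2 * y ^ 2 + ovalMid x) ^ 2 - ovalDisc x) := by
  rw [hess_ovalQuartic]
  simp [ovalDisc, ovalMid, ovalConst]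
  ring

theorem eval_hess_ovalQuartic_eq_zero_iff (x y : ℝ) : eval ![x, y] (Hess ovalQuartic) = 0 ↔
    (2 * y ^ 2 + ovalMid x) ^ 2 = ovalDisc x := by
  rw [eval_hess_ovalQuartic, mul_eq_zero, sub_eq_zero]
  norm_num

theorem eval_pderiv_zero_hess_ovalQuartic (x y : ℝ) :
    eval ![x, y] (pderiv 0 (Hess ovalQuartic)) =
      -120600 * (2 * (2 * y ^ 2 + ovalMid x) * -(79599 / 20100 * x + 3 / 2) -
        (-14239911 / 179560000 * (4 * x ^ 3) + 159599 / 13400 * (3 * x ^ 2) +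
          -18299359 / 448900 * (2 * x) + 2056 / 67)) := by
  rw [hess_ovalQuartic]
  simp [Derivation.leibniz_pow, ovalMid]
  ring

theorem eval_pderiv_one_hess_ovalQuartic (x y : ℝ) :
    eval ![x, y] (pderiv 1 (Hess ovalQuartic)) =
      -120600 * (8 * y * (2 * y ^ 2 + ovalMid x)) := by
  rw [hess_ovalQuartic]
  simp [Derivation.leibniz_pow, ovalMid]
  ring

theorem totalDegree_ovalQuartic : ovalQuartic.totalDegree = 4 := by
  apply le_antisymm
  · have hC : ∀ (a : ℝ) (p : MvPolynomial (Fin 2) ℝ), p.totalDegree ≤ 4 →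
        (C a * p).totalDegree ≤ 4 := fun a p hp => (totalDegree_mul _ _).trans (by simpa using hp)
    have hX : ∀ (i : Fin 2) (n : ℕ), (X i ^ n : MvPolynomial (Fin 2) ℝ).totalDegree = n :=
      totalDegree_X_pow
    unfold ovalQuartic
    refine (totalDegree_sub _ _).trans (max_le ((totalDegree_add _ _).trans (max_le
      ((totalDegree_add _ _).trans (max_le ((totalDegree_sub _ _).trans (max_le
      ((totalDegree_add _ _).trans (max_le ?_ ?_)) ?_)) ?_)) ?_)) ?_) <;> apply hC
    · exact (hX _ _).le
    · exact (hX _ _).le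
    · exact (totalDegree_mul _ _).trans (by rw [hX, hX])
    · rw [hX]; norm_num
    · exact (totalDegree_mul _ _).trans (by rw [hX, totalDegree_X]; norm_num)
    · rw [hX]; norm_num
  · have h := aeval_natDegree_le ovalQuartic le_rfl ![(Polynomial.X : Polynomial ℝ), 0] (n := 1)
      (by intro i; fin_cases i <;> simp)
    have h4 : aeval ![(Polynomial.X : Polynomial ℝ), 0] ovalQuartic =
        Polynomial.C 100 * Polynomial.X ^ 4 + Polynomial.C 600 * Polynomial.X ^ 2 := by
      simp [ovalQuartic]
    have h5 : (Polynomial.C 100 * Polynomial.X ^ 4 + Polynomial.C 600 * Polynomial.X ^ 2 :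
        Polynomial ℝ).natDegree = 4 := by
      compute_degree!
    rw [h4, h5] at h
    omega

theorem exists_ovalDisc_eq : ∃ r₁ r₂ r₃ r₄, r₁ < r₂ ∧ r₂ < r₃ ∧ r₃ < r₄ ∧ ∀ x, ovalDisc x =
    -14239911 / 179560000 * ((x - r₁) * (x - r₂) * (x - r₃) * (x - r₄)) := by
  apply exists_factorization_of_signs (s₀ := 0) (s₁ := 1 / 2) (s₂ := 1) (s₃ := 3) (s₄ := 1000)
    ovalDisc_eq <;> norm_num [ovalDisc_eq]

theorem gradient_hess_ovalQuartic_ne_zero (x y : ℝ)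
    (h : eval ![x, y] (Hess ovalQuartic) = 0) :
    (eval ![x, y] (pderiv 0 (Hess ovalQuartic)), eval ![x, y] (pderiv 1 (Hess ovalQuartic)))
      ≠ (0, 0) := by
  intro hgrad
  obtain ⟨hx, hy⟩ := Prod.mk.inj hgrad
  rw [eval_hess_ovalQuartic_eq_zero_iff] at h
  rw [eval_pderiv_zero_hess_ovalQuartic] at hx
  rw [eval_pderiv_one_hess_ovalQuartic] at hy
  have hy0 : y ≠ 0 := by
    rintro rfl
    have := ovalConst_pos x
    unfold ovalDisc at h
    nlinarith
  have hmid : 2 * y ^ 2 + ovalMid x = 0 := by simpa [hy0] using hy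
  rw [hmid] at h hx
  obtain ⟨r₁, r₂, r₃, r₄, h12, h23, h34, hr⟩ := exists_ovalDisc_eq
  have hderiv : HasDerivAt ovalDisc (-14239911 / 179560000 * (4 * x ^ 3) +
      159599 / 13400 * (3 * x ^ 2) + -18299359 / 448900 * (2 * x) + 2056 / 67) x := by
    rw [funext ovalDisc_eq]
    have h2 := hasDerivAt_pow 2 x
    have h3 := hasDerivAt_pow 3 x
    have h4 := hasDerivAt_pow 4 x
    have h := (((((h4.const_mul (-14239911 / 179560000 : ℝ)).add
      (h3.const_mul (159599 / 13400 : ℝ))).add (h2.const_mul (-18299359 / 448900 : ℝ))).add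
      ((hasDerivAt_id x).const_mul (2056 / 67 : ℝ))).add_const (-16896 / 4489 : ℝ))
    exact h.congr_deriv (by norm_num)
  have hderiv' : HasDerivAt ovalDisc (-14239911 / 179560000 *
      (((1 * (x - r₂) + (x - r₁) * 1) * (x - r₃) + (x - r₁) * (x - r₂) * 1) * (x - r₄) +
        (x - r₁) * (x - r₂) * (x - r₃) * 1)) x := by
    rw [funext hr]
    have hs := fun r : ℝ => (hasDerivAt_id x).sub_const r
    exact ((((hs r₁).mul (hs r₂)).mul (hs r₃)).mul (hs r₄)).const_mul _
  have hzero := hderiv.unique hderiv'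
  rw [show -14239911 / 179560000 * (4 * x ^ 3) + 159599 / 13400 * (3 * x ^ 2) +
    -18299359 / 448900 * (2 * x) + 2056 / 67 = 0 by linarith] at hzero
  have hroot : (x - r₁) * (x - r₂) * (x - r₃) * (x - r₄) = 0 := by
    have := hr x
    rw [← h] at this
    linarith
  have h13 := h12.trans h23
  have h24 := h23.trans h34
  have h14 := h12.trans h24
  simp only [mul_eq_zero, sub_eq_zero, or_assoc] at hroot
  rcases hroot with rfl | rfl | rfl | rfl <;>
    simp [sub_eq_zero, h12.ne, h12.ne', h13.ne, h13.ne', h14.ne, h14.ne', h23.ne, h23.ne', h24.ne,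
      h24.ne', h34.ne, h34.ne'] at hzero

/-- There is a real polynomial of degree 4 in two variables whose hessian curve is
smooth, compact, and consists of exactly four ovals. -/
theorem quartic_with_four_ovals :
    ∃ f : MvPolynomial (Fin 2) ℝ, f.totalDegree = 4 ∧
      IsCompact {p : ℝ × ℝ | eval ![p.1, p.2] (Hess f) = 0} ∧
      (∀ p : ℝ × ℝ, eval ![p.1, p.2] (Hess f) = 0 →
        (eval ![p.1, p.2] (pderiv 0 (Hess f)), eval ![p.1, p.2] (pderiv 1 (Hess f)))
          ≠ (0, 0)) ∧
      (components {p : ℝ × ℝ | eval ![p.1, p.2] (Hess f) = 0}).ncard = 4 := by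
  obtain ⟨r₁, r₂, r₃, r₄, h12, h23, h34, hr⟩ := exists_ovalDisc_eq
  let a : Bool → ℝ := fun i => bif i then r₁ else r₃
  let b : Bool → ℝ := fun i => bif i then r₂ else r₄
  let σ : Bool → ℝ := fun i => bif i then 1 else -1
  let S : Bool × Bool → Set (ℝ × ℝ) := fun i => oval ovalMid ovalDisc (a i.1) (b i.1) (σ i.2)
  have hab : ∀ i, a i ≤ b i := by rintro (_ | _); exacts [h34.le, h12.le]
  have hσ : ∀ i, σ i ^ 2 = 1 := by rintro (_ | _) <;> simp [σ]
  have hda : ∀ i, ovalDisc (a i) = 0 := by rintro (_ | _) <;> simp [a, hr]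
  have hnonneg : ∀ x, 0 ≤ ovalDisc x ↔ ∃ i, x ∈ Set.Icc (a i) (b i) := by
    intro x
    simp only [Bool.exists_bool, a, b, cond_true, cond_false, Set.mem_Icc]
    rw [hr]
    constructor
    · intro h
      by_contra! hcon
      have hpos : 0 < (x - r₁) * (x - r₂) * (x - r₃) * (x - r₄) := by
        rcases lt_or_ge x r₁ with h1 | h1
        · have := mul_pos (mul_pos (sub_pos.2 h1) (sub_pos.2 (h1.trans h12)))
            (mul_pos (sub_pos.2 (h1.trans (h12.trans h23)))
              (sub_pos.2 (h1.trans (h12.trans (h23.trans h34)))))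
          linarith
        have h2 := hcon.2 h1
        rcases lt_or_ge x r₃ with h3 | h3
        · have := mul_pos (mul_pos (sub_pos.2 (h12.trans h2)) (sub_pos.2 h2))
            (mul_pos (sub_pos.2 h3) (sub_pos.2 (h3.trans h34)))
          linarith
        have h4 := hcon.1 h3
        exact mul_pos (mul_pos (mul_pos (sub_pos.2 (h12.trans h2)) (sub_pos.2 h2))
          (sub_pos.2 (h34.trans h4))) (sub_pos.2 h4)
      linarith
    · rintro (⟨h3, h4⟩ | ⟨h1, h2⟩)
      · have := mul_nonneg (mul_nonneg (mul_nonneg (sub_nonneg.2 (h12.le.trans (h23.le.trans h3)))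
          (sub_nonneg.2 (h23.le.trans h3))) (sub_nonneg.2 h3)) (sub_nonneg.2 h4)
        linarith
      · have := mul_nonneg (mul_nonneg (sub_nonneg.2 h1) (sub_nonneg.2 h2))
          (mul_nonneg (sub_nonneg.2 (h2.trans h23.le))
            (sub_nonneg.2 (h2.trans (h23.trans h34).le)))
        linarith
  have hd : ∀ i, ∀ x ∈ Set.Icc (a i) (b i), 0 ≤ ovalDisc x := fun i x hx =>
    (hnonneg x).2 ⟨i, hx⟩
  have hp : ∀ x, √(ovalDisc x) < -ovalMid x := by
    intro x
    rw [Real.sqrt_lt' (neg_pos.2 (ovalMid_neg x)), neg_sq]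
    linarith [ovalConst_pos x, show ovalDisc x = ovalMid x ^ 2 - 4 * ovalConst x from rfl]
  have hmc : Continuous ovalMid := by unfold ovalMid; fun_prop
  have hdc : Continuous ovalDisc := by rw [funext ovalDisc_eq]; fun_prop
  have hcompact : ∀ i, IsCompact (S i) := fun i =>
    isCompact_oval hmc hdc (hσ _) (hd _) fun x _ => hp x
  have hconn : ∀ i, IsConnected (S i) := fun i =>
    isConnected_oval hmc hdc (hσ _) (hab _) (hd _) (fun x _ => hp x) (hda _)
  have hdisj : Pairwise fun i j => Disjoint (S i) (S j) := by
    intro i j hij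
    rw [Set.disjoint_left]
    rintro z ⟨⟨hai, hbi⟩, hyi, -⟩ ⟨⟨haj, hbj⟩, hyj, -⟩
    apply hij
    rcases i with ⟨_ | _, _ | _⟩ <;> rcases j with ⟨_ | _, _ | _⟩ <;>
      simp only [a, b, σ, cond_true, cond_false] at hai hbi haj hbj hyi hyj <;>
      first | rfl | (exfalso; linarith)
  have hZ : {p : ℝ × ℝ | eval ![p.1, p.2] (Hess ovalQuartic) = 0} = ⋃ i, S i := by
    ext z
    rw [Set.mem_ofPred_eq, eval_hess_ovalQuartic_eq_zero_iff, Set.mem_iUnion]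
    constructor
    · intro h
      obtain ⟨i, hi⟩ := (hnonneg z.1).1 (h ▸ sq_nonneg _)
      have hy : z.2 ≠ 0 := by
        intro hy
        rw [hy] at h
        have := ovalConst_pos z.1
        unfold ovalDisc at h
        nlinarith
      rcases hy.lt_or_gt with hy | hy
      · exact ⟨(i, false), hi, by simpa [σ] using hy, h⟩
      · exact ⟨(i, true), hi, by simpa [σ] using hy, h⟩
    · rintro ⟨i, -, -, h⟩
      exact h
  refine ⟨ovalQuartic, totalDegree_ovalQuartic, ?_, fun p => gradient_hess_ovalQuartic_ne_zero _ _,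
    ?_⟩
  · rw [hZ]
    exact isCompact_iUnion hcompact
  · rw [hZ, ncard_components_iUnion (fun i => (hcompact i).isClosed) hconn hdisj]
    simp
end

section
/- Let h(x,y) = 25 − 134x − 374y + 91x² + 948xy + 1137y² + 429x³ + 612x²y − 2313xy² − 876y³ + 63x⁴ + 54x³y − 99x²y² − 234xy³ + 675y⁴. Then the set Z = {(x,y) ∈ ℝ² : h(x,y) = 0} is compact, the gradient (∂h/∂x, ∂h/∂y) is nonzero at every point of Z, and Z has exactly 4 connected components. -/
/-- The quartic polynomial function `h`. -/
def h (x y : ℝ) : ℝ :=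
  25 - 134 * x - 374 * y + 91 * x ^ 2 + 948 * x * y + 1137 * y ^ 2
    + 429 * x ^ 3 + 612 * x ^ 2 * y - 2313 * x * y ^ 2 - 876 * y ^ 3
    + 63 * x ^ 4 + 54 * x ^ 3 * y - 99 * x ^ 2 * y ^ 2 - 234 * x * y ^ 3 + 675 * y ^ 4

open Set Topology

/-- A function whose derivative is positive at each of its zeros in `[a, b]` has no zero in
`(a, b)` if it vanishes at `b`. -/
theorem ne_zero_of_deriv_pos_at_zeros {g g' : ℝ → ℝ} {a b : ℝ}
    (hg : ∀ t, HasDerivAt g (g' t) t) (hb : g b = 0)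
    (hpos : ∀ t ∈ Icc a b, g t = 0 → 0 < g' t) : ∀ t ∈ Ioo a b, g t ≠ 0 := by
  intro t ht h0
  have hrefl : ∀ s, HasDerivAt (fun s => g (b - s)) (-g' (b - s)) s := fun s => by
    simpa using (hg (b - s)).comp_const_sub b s
  have hle : ∀ s ∈ Icc a b, g s ≤ 0 := fun s hs => by
    have := image_le_of_deriv_right_lt_deriv_boundary (a := 0) (b := b - a) (B := fun _ => 0)
      (B' := fun _ => 0) (fun r _ => (hrefl r).continuousAt.continuousWithinAt)
      (fun r _ => (hrefl r).hasDerivWithinAt) (by simp [hb]) (fun r => hasDerivAt_const r 0)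
      (fun r hr h => neg_neg_of_pos (hpos _ ⟨by linarith [hr.2], by linarith [hr.1]⟩ h))
      (x := b - s) ⟨by linarith [hs.2], by linarith [hs.1]⟩
    simpa using this
  have hmax : IsLocalMax g t := by
    filter_upwards [Ioo_mem_nhds ht.1 ht.2] with s hs
    rw [h0]
    exact hle s (Ioo_subset_Icc_self hs)
  exact (hpos t (Ioo_subset_Icc_self ht) h0).ne' (hmax.hasDerivAt_eq_zero (hg t))

/-- Let `U` be an open convex set with `f > 0` on its boundary, `p ∈ U` a point with `f p < 0`,
and suppose that `f` increases in the direction away from `p` at each of its zeros in `U`. Then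
radial projection from `p` is a homeomorphism from the zero set of `f` in `U` to the unit sphere,
so this zero set is connected. -/
theorem isConnected_inter_zeros_of_radial {E : Type*} [NormedAddCommGroup E] [NormedSpace ℝ E]
    (hE : 1 < Module.rank ℝ E) {f : E → ℝ} {f' : E → E →L[ℝ] ℝ}
    (hf : ∀ q, HasFDerivAt f (f' q) q) {U : Set E} (hU : IsOpen U) (hconv : Convex ℝ U)
    {p : E} (hpU : p ∈ U) (hp : f p < 0) (hfront : ∀ q ∈ frontier U, 0 < f q)
    (hbdd : Bornology.IsBounded {q | f q ≤ 0}) (hcomp : IsCompact {q | f q = 0})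
    (hrad : ∀ q ∈ U, f q = 0 → 0 < f' q (q - p)) : IsConnected (U ∩ {q | f q = 0}) := by
  have hfc : Continuous f := continuous_iff_continuousAt.2 fun q => (hf q).continuousAt
  have hmem : ∀ q ∈ closure U, f q ≤ 0 → q ∈ U := fun q hq h => by
    by_contra hqU
    exact (hfront q (hU.frontier_eq ▸ ⟨hq, hqU⟩)).not_ge h
  have hZ : IsCompact (U ∩ {q | f q = 0}) := by
    have : U ∩ {q | f q = 0} = {q | f q = 0} ∩ closure U := by
      ext q
      exact ⟨fun h => ⟨h.2, subset_closure h.1⟩, fun h => ⟨hmem q h.2 h.1.le, h.1⟩⟩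
    rw [this]
    exact hcomp.inter_right isClosed_closure
  have hne : ∀ q ∈ U ∩ {q | f q = 0}, 0 < ‖q - p‖ := fun q hq => by
    rw [norm_pos_iff, sub_ne_zero]
    rintro rfl
    exact hp.ne hq.2
  have hray : ∀ (w : E) (t : ℝ), HasDerivAt (fun s : ℝ => f (p + s • w)) (f' (p + t • w) w) t :=
    fun w t => by
      have : HasDerivAt (fun s : ℝ => p + s • w) w t := by
        simpa using ((hasDerivAt_id t).smul_const w).const_add p
      exact (hf _).comp_hasDerivAt t this
  -- a ray from `p` contains at most one zero
  have huniq : ∀ (w : E) (s t : ℝ), 0 < s → s < t → p + t • w ∈ U → f (p + s • w) = 0 →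
      f (p + t • w) ≠ 0 := by
    intro w s t hs hst htU hs0 ht0
    refine ne_zero_of_deriv_pos_at_zeros (hray w) ht0 (a := 0) ?_ s ⟨hs, hst⟩ hs0
    intro r hr hr0
    have ht : 0 < t := hs.trans hst
    have hrU : p + r • w ∈ U := by
      have := hconv.add_smul_sub_mem hpU htU
        (t := r / t) ⟨div_nonneg hr.1 ht.le, (div_le_one ht).2 hr.2⟩
      rwa [add_sub_cancel_left, smul_smul, div_mul_cancel₀ _ ht.ne'] at this
    have hr' : 0 < r := by
      refine hr.1.lt_of_ne ?_
      rintro rfl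
      simp [hp.ne] at hr0
    have := hrad _ hrU hr0
    rw [add_sub_cancel_left, map_smul, smul_eq_mul] at this
    exact (mul_pos_iff_of_pos_left hr').1 this
  have hexists : ∀ w : E, ‖w‖ = 1 → ∃ t : ℝ, 0 < t ∧ p + t • w ∈ U ∩ {q | f q = 0} := by
    intro w hw
    have hW : IsOpen (U ∩ {q | f q < 0}) := hU.inter (isOpen_lt hfc continuous_const)
    have hpre : IsPreconnected ((fun t : ℝ => p + t • w) '' Ici 0) :=
      isPreconnected_Ici.image _ (by fun_prop)
    obtain ⟨R, hR⟩ := hbdd.subset_closedBall p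
    obtain ⟨_, ⟨hcl, t, ht, rfl⟩, hnot⟩ : ∃ q ∈ closure (U ∩ {q | f q < 0}) ∩
        (fun t : ℝ => p + t • w) '' Ici 0, q ∉ U ∩ {q | f q < 0} := by
      by_contra! hsub
      have hmem := hpre.subset_of_closure_inter_subset hW ⟨p, ⟨0, by simp, by simp⟩, hpU, hp⟩ hsub
        ⟨|R| + 1, mem_Ici.2 (by positivity), rfl⟩
      have hlt : f (p + (|R| + 1) • w) < 0 := hmem.2
      have := hR (show f (p + (|R| + 1) • w) ≤ 0 from hlt.le)
      rw [mem_closedBall_iff_norm, add_sub_cancel_left, norm_smul, hw, mul_one,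
        Real.norm_eq_abs, abs_of_pos (by positivity)] at this
      linarith [le_abs_self R]
    have hle : f (p + t • w) ≤ 0 :=
      closure_minimal (t := {q | f q ≤ 0}) (fun q (hq : q ∈ U ∧ f q < 0) => hq.2.le)
        (isClosed_le hfc continuous_const) hcl
    have htU := hmem _ (closure_mono inter_subset_left hcl) hle
    have h0 : f (p + t • w) = 0 := hle.antisymm (not_lt.1 fun h => hnot ⟨htU, h⟩)
    refine ⟨t, (mem_Ici.1 ht).lt_of_ne ?_, htU, h0⟩
    rintro rfl
    simp [hp.ne] at h0
  let φ : (U ∩ {q | f q = 0} : Set E) → Metric.sphere (0 : E) 1 := fun q =>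
    ⟨‖(q : E) - p‖⁻¹ • ((q : E) - p), by
      simp [norm_smul, (hne q q.2).ne']⟩
  have hφ : Continuous φ := by
    refine Continuous.subtype_mk (Continuous.smul (Continuous.inv₀ (by fun_prop) fun q => ?_)
      (by fun_prop)) _
    exact (hne q q.2).ne'
  have hφq : ∀ q : (U ∩ {q | f q = 0} : Set E), p + ‖(q : E) - p‖ • (φ q : E) = q := fun q => by
    simp [φ, smul_smul, (hne q q.2).ne']
  have hbij : Function.Bijective φ := by
    refine ⟨fun q r hqr => ?_, fun w => ?_⟩
    · have hq := hφq q
      have hr := hφq r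
      rw [← hqr] at hr
      have hq0 := q.2.2
      have hr0 := r.2.2
      have hqU := q.2.1
      have hrU := r.2.1
      rw [mem_ofPred_eq, ← hq] at hq0
      rw [mem_ofPred_eq, ← hr] at hr0
      rcases lt_trichotomy ‖(q : E) - p‖ ‖(r : E) - p‖ with hlt | heq | hlt
      · rw [← hr] at hrU
        exact absurd hr0 (huniq _ _ _ (hne q q.2) hlt hrU hq0)
      · exact Subtype.ext (by rw [← hq, ← hr, heq])
      · rw [← hq] at hqU
        exact absurd hq0 (huniq _ _ _ (hne r r.2) hlt hqU hr0)
    · have hw : ‖(w : E)‖ = 1 := by simp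
      obtain ⟨t, ht, hmem⟩ := hexists w hw
      exact ⟨⟨_, hmem⟩, Subtype.ext (by simp [φ, norm_smul, hw, abs_of_pos ht, smul_smul, ht.ne'])⟩
  have : CompactSpace (U ∩ {q | f q = 0} : Set E) := isCompact_iff_compactSpace.1 hZ
  let e := Continuous.homeoOfEquivCompactToT2 (f := Equiv.ofBijective φ hbij) hφ
  have : ConnectedSpace (Metric.sphere (0 : E) 1) :=
    isConnected_iff_connectedSpace.1 (isConnected_sphere hE 0 zero_le_one)
  have := e.symm.surjective.connectedSpace e.symm.continuous
  exact isConnected_iff_connectedSpace.2 this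

/-- If `Z` is covered by disjoint open sets each of which meets `Z` in a connected set, then
these intersections are the connected components of `Z`. -/
theorem ncard_components_of_open_cover {ι : Type*} {Z : Set (ℝ × ℝ)} {U : ι → Set (ℝ × ℝ)}
    (hU : ∀ i, IsOpen (U i)) (hdisj : Pairwise (Function.onFun Disjoint U))
    (hZ : Z ⊆ ⋃ i, U i) (hconn : ∀ i, IsConnected (U i ∩ Z)) :
    (components Z).ncard = Nat.card ι := by
  have hcomp : ∀ i, ∀ p ∈ U i ∩ Z, connectedComponentIn Z p = U i ∩ Z := by
    intro i p hp
    refine (subset_inter ?_ (connectedComponentIn_subset Z p)).antisymm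
      ((hconn i).isPreconnected.subset_connectedComponentIn hp inter_subset_right)
    refine isPreconnected_connectedComponentIn.subset_left_of_subset_union (hU i)
      (isOpen_iUnion fun j : {j // j ≠ i} => hU j)
      (disjoint_iUnion_right.2 fun j => hdisj j.2.symm) (fun q hq => ?_)
      ⟨p, mem_connectedComponentIn hp.2, hp.1⟩
    obtain ⟨j, hj⟩ := mem_iUnion.1 (hZ (connectedComponentIn_subset Z p hq))
    by_cases hji : j = i
    · exact Or.inl (hji ▸ hj)
    · exact Or.inr (mem_iUnion.2 ⟨⟨j, hji⟩, hj⟩)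
  have hrange : components Z = range fun i => U i ∩ Z := by
    ext C
    constructor
    · rintro ⟨p, hp, rfl⟩
      obtain ⟨i, hi⟩ := mem_iUnion.1 (hZ hp)
      exact ⟨i, (hcomp i p ⟨hi, hp⟩).symm⟩
    · rintro ⟨i, rfl⟩
      obtain ⟨p, hp⟩ := (hconn i).nonempty
      exact ⟨p, hp.2, (hcomp i p hp).symm⟩
  rw [hrange]
  refine ncard_range_of_injective fun i j hij => ?_
  by_contra hne
  obtain ⟨p, hp⟩ := (hconn i).nonempty
  have hp' : p ∈ U j ∩ Z := hij ▸ hp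
  exact disjoint_left.1 (hdisj hne) hp.1 hp'.1

/-- The partial derivative of `h` in the first variable. -/
def hX (x y : ℝ) : ℝ :=
  -134 + 182 * x + 948 * y + 1287 * x ^ 2 + 1224 * x * y - 2313 * y ^ 2
    + 252 * x ^ 3 + 162 * x ^ 2 * y - 198 * x * y ^ 2 - 234 * y ^ 3

/-- The partial derivative of `h` in the second variable. -/
def hY (x y : ℝ) : ℝ :=
  -374 + 948 * x + 2274 * y + 612 * x ^ 2 - 4626 * x * y - 2628 * y ^ 2
    + 54 * x ^ 3 - 198 * x ^ 2 * y - 702 * x * y ^ 2 + 2700 * y ^ 3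

theorem abs_monomial_le (u v : ℝ) (i j : ℕ) (hij : i + j ≤ 6) :
    |u ^ i * v ^ j| ≤ 1 + u ^ 6 + v ^ 6 := by
  obtain ⟨m, hm1, hmu, hmv, hm⟩ : ∃ m : ℝ, 1 ≤ m ∧ |u| ≤ m ∧ |v| ≤ m ∧ m ^ 6 ≤ 1 + u ^ 6 + v ^ 6 := by
    have hu : |u| ^ 6 = u ^ 6 := Even.pow_abs (by decide) u
    have hv : |v| ^ 6 = v ^ 6 := Even.pow_abs (by decide) v
    have hu0 : 0 ≤ u ^ 6 := by positivity
    have hv0 : 0 ≤ v ^ 6 := by positivity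
    refine ⟨max 1 (max |u| |v|), by simp, by simp, by simp, ?_⟩
    rcases max_choice 1 (max |u| |v|) with h | h <;> rw [h]
    · linarith
    · rcases max_choice |u| |v| with h | h <;> rw [h] <;> linarith
  calc |u ^ i * v ^ j| = |u| ^ i * |v| ^ j := by rw [abs_mul, abs_pow, abs_pow]
    _ ≤ m ^ i * m ^ j := by gcongr
    _ = m ^ (i + j) := (pow_add m i j).symm
    _ ≤ m ^ 6 := pow_le_pow_right₀ hm1 hij
    _ ≤ 1 + u ^ 6 + v ^ 6 := hm

theorem monomial_le (u v : ℝ) (i j : ℕ) (hij : i + j ≤ 6 := by norm_num) :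
    u ^ i * v ^ j ≤ 1 + u ^ 6 + v ^ 6 :=
  (le_abs_self _).trans (abs_monomial_le u v i j hij)

theorem neg_monomial_le (u v : ℝ) (i j : ℕ) (hij : i + j ≤ 6 := by norm_num) :
    -(u ^ i * v ^ j) ≤ 1 + u ^ 6 + v ^ 6 :=
  (neg_le_abs _).trans (abs_monomial_le u v i j hij)

/- The four positivity certificates below have the same shape: in coordinates `u, v` centred inside
the oval, the radial derivative of `h` minus a multiple of `h` is a sum of squares, plus squares
times the linear forms bounding the region, plus a remainder that is positive because its
coefficients at `1`, `u ^ 6` and `v ^ 6` dominate the others. -/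

theorem radialDeriv_pos_west {x y : ℝ} (h0 : h x y = 0) (h1 : x < -2 / 5) :
    0 < (x + 47 / 10) * hX x y + (y + 3 / 20) * hY x y := by
  obtain ⟨u, rfl⟩ : ∃ u, x = 3 * u - 47 / 10 := ⟨(x + 47 / 10) / 3, by ring⟩
  obtain ⟨v, rfl⟩ : ∃ v, y = 3 * v - 3 / 20 := ⟨(y + 3 / 20) / 3, by ring⟩
  have hl : (4711 / 50 + 5331 / 100 * u + 883 / 100 * v - 2784 / 25 * u ^ 2 + 2819 / 25 * u * v -
      18663 / 20 * v ^ 2) * h (3 * u - 47 / 10) (3 * v - 3 / 20) = 0 := by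
    rw [h0, mul_zero]
  replace h1 : 0 < -u + 43 / 30 := by linarith
  have s0 : 0 ≤
      1155546477 / 2000000 * (v ^ 3 - 93501 / 400000 * u * v ^ 2 - 20763 / 312500 * u ^ 2 * v +
      113913 / 10000000 * u ^ 3 - 494721 / 10000000 * v ^ 2 + 13537 / 125000 * u * v -
      38881 / 2000000 * u ^ 2 - 372227 / 5000000 * v + 60313 / 10000000 * u +
      70393 / 10000000) ^ 2 +
      5362000091 / 100000000 * (u * v ^ 2 + 33783 / 2500000 * u ^ 2 * v +
      1705051 / 5000000 * u ^ 3 - 38284901 / 10000000 * v ^ 2 + 3561991 / 10000000 * u * v -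
      7447029 / 10000000 * u ^ 2 + 38637 / 2000000 * v + 363271 / 10000000 * u +
      2203827 / 5000000) ^ 2 +
      54352547 / 25000000 * (u ^ 2 * v - 1425493 / 10000000 * u ^ 3 + 6827687 / 10000000 * v ^ 2 -
      745363 / 1000000 * u * v + 963619 / 5000000 * u ^ 2 - 1812163 / 10000000 * v +
      105089 / 10000000 * u - 173017 / 2000000) ^ 2 +
      160973 / 2000000 * (u ^ 3 - 94719839 / 10000000 * v ^ 2 + 11146003 / 10000000 * u * v -
      5523861 / 2500000 * u ^ 2 + 1172513 / 10000000 * v + 1129077 / 5000000 * u +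
      373427 / 312500) ^ 2 +
      13199607 / 50000000 * (v ^ 2 - 667999 / 5000000 * u * v + 25553 / 10000000 * u ^ 2 -
      51077 / 10000000 * v + 462709 / 10000000 * u - 59319 / 1000000) ^ 2 +
      3260277 / 100000000 * (u * v - 318527 / 5000000 * u ^ 2 - 107993 / 200000 * v +
      219019 / 10000000 * u + 122051 / 10000000) ^ 2 +
      35937 / 25000000 * (u ^ 2 - 156783 / 2000000 * v - 2490709 / 2500000 * u +
      1581831 / 10000000) ^ 2 +
      466363 / 50000000 * (v - 21657 / 312500 * u - 3951 / 2000000) ^ 2 +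
      31453 / 20000000 * (u - 2152993 / 5000000) ^ 2 := by
    positivity
  have s1 : 0 ≤ (-u + 43 / 30) * (
      5859216301 / 50000000 * (v ^ 2 - 1205443 / 10000000 * u * v + 38921 / 400000 * u ^ 2 -
      22267 / 2500000 * v - 100167 / 2000000 * u - 481257 / 5000000) ^ 2 +
      393523 / 12500000 * (u * v - 111617 / 2000000 * u ^ 2 - 1338509 / 5000000 * v -
      28893 / 5000000 * u + 19707 / 10000000) ^ 2 +
      314743 / 100000000 * (u ^ 2 - 30531 / 2500000 * v - 35411 / 40000 * u -
      1638733 / 5000000) ^ 2 +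
      909577 / 100000000 * (v - 601987 / 10000000 * u - 133263 / 10000000) ^ 2 +
      23449 / 20000000 * (u - 3160467 / 10000000) ^ 2 +
      9901 / 10000000) :=
    mul_nonneg h1.le (by positivity)
  rw [hX, hY]
  rw [h] at hl
  linarith [
    monomial_le u v 0 1, monomial_le u v 0 2, neg_monomial_le u v 0 3, monomial_le u v 0 4,
    neg_monomial_le u v 0 5, neg_monomial_le u v 1 0, neg_monomial_le u v 1 1,
    monomial_le u v 1 2, monomial_le u v 1 3, monomial_le u v 1 4, neg_monomial_le u v 1 5,
    monomial_le u v 2 0, monomial_le u v 2 1, neg_monomial_le u v 2 2, monomial_le u v 2 3,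
    monomial_le u v 2 4, neg_monomial_le u v 3 0, neg_monomial_le u v 3 1, monomial_le u v 3 2,
    monomial_le u v 3 3, monomial_le u v 4 0, neg_monomial_le u v 4 1, neg_monomial_le u v 4 2,
    monomial_le u v 5 0, monomial_le u v 5 1]

theorem radialDeriv_pos_middle {x y : ℝ} (h0 : h x y = 0) (h1 : -2 / 5 < x) (h2 : -2 / 25 < y)
    (h3 : y < 3 / 5) :
    0 < (x - 1 / 10) * hX x y + (y - 1 / 5) * hY x y := by
  obtain ⟨u, rfl⟩ : ∃ u, x = 1 / 4 * u + 1 / 10 := ⟨(x - 1 / 10) / (1 / 4), by ring⟩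
  obtain ⟨v, rfl⟩ : ∃ v, y = 1 / 4 * v + 1 / 5 := ⟨(y - 1 / 5) / (1 / 4), by ring⟩
  have hl : (21 / 10 - 4 / 5 * u - 3 / 5 * v - 43 / 10 * u ^ 2 - 7 / 10 * u * v - 87 / 10 * v ^ 2)
      * h (1 / 4 * u + 1 / 10) (1 / 4 * v + 1 / 5) = 0 := by
    rw [h0, mul_zero]
  replace h1 : 0 < u + 2 := by linarith
  replace h2 : 0 < v + 28 / 25 := by linarith
  replace h3 : 0 < -v + 8 / 5 := by linarith
  have s0 : 0 ≤
      2897 / 5000 * (v ^ 3 - 17 / 125 * u * v ^ 2 - 209 / 500 * u ^ 2 * v - 17 / 500 * u ^ 3 +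
      107 / 500 * v ^ 2 + 81 / 200 * u * v - 143 / 1000 * u ^ 2 - 339 / 1000 * v + 3 / 1000 * u +
      19 / 500) ^ 2 +
      6633 / 10000 * (u * v ^ 2 - 33 / 500 * u ^ 2 * v - 19 / 200 * u ^ 3 - 1219 / 1000 * v ^ 2 -
      227 / 1000 * u * v - 423 / 1000 * u ^ 2 + 1 / 250 * v - 3 / 40 * u + 323 / 1000) ^ 2 +
      321 / 10000 * (u ^ 2 * v + 51 / 1000 * u ^ 3 - 487 / 1000 * v ^ 2 - 199 / 200 * u * v +
      181 / 1000 * u ^ 2 + 303 / 1000 * v + 133 / 1000 * u + 159 / 1000) ^ 2 +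
      13 / 2000 * (u ^ 3 + 1 / 50 * v ^ 2 + 27 / 200 * u * v + 391 / 1000 * u ^ 2 + 571 / 1000 * v
      + 81 / 250 * u - 97 / 125) ^ 2 +
      1003 / 10000 * (v ^ 2 + 109 / 500 * u * v + 151 / 1000 * u ^ 2 + 13 / 200 * v +
      29 / 1000 * u - 7 / 40) ^ 2 +
      477 / 5000 * (u * v - 63 / 1000 * u ^ 2 - 11 / 100 * v + 27 / 250 * u + 3 / 50) ^ 2 +
      51 / 2500 * (u ^ 2 - 131 / 1000 * v - 17 / 500 * u - 63 / 1000) ^ 2 +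
      91 / 5000 * (v - 26 / 125 * u + 39 / 1000) ^ 2 +
      189 / 10000 * (u + 211 / 1000) ^ 2 := by
    positivity
  have s1 : 0 ≤ (u + 2) * (
      1341 / 10000 * (v ^ 2 - 157 / 125 * u * v - 203 / 100 * u ^ 2 - 1 / 20 * v - 917 / 1000 * u
      + 279 / 500) ^ 2 +
      489 / 5000 * (u * v + 581 / 500 * u ^ 2 + 9 / 500 * v + 249 / 500 * u - 181 / 500) ^ 2 +
      323 / 5000 * (u ^ 2 + 7 / 200 * v + 143 / 500 * u - 107 / 500) ^ 2 +
      109 / 5000 * (v + 21 / 1000 * u - 1 / 250) ^ 2 +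
      117 / 5000 * (u - 8 / 125) ^ 2 +
      221 / 10000) :=
    mul_nonneg h1.le (by positivity)
  have s2 : 0 ≤ (v + 28 / 25) * (
      233 / 200 * (v ^ 2 - 1543 / 1000 * u * v + 17 / 50 * u ^ 2 + 77 / 250 * v + 9 / 1000 * u -
      189 / 500) ^ 2 +
      1519 / 10000 * (u * v - 47 / 250 * u ^ 2 - 189 / 1000 * v - 11 / 200 * u + 71 / 500) ^ 2 +
      223 / 10000 * (u ^ 2 + 59 / 1000 * v + 29 / 500 * u - 6 / 125) ^ 2 +
      239 / 10000 * (v + 1 / 40 * u - 31 / 1000) ^ 2 +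
      221 / 10000 * (u + 9 / 1000) ^ 2 +
      109 / 5000) :=
    mul_nonneg h2.le (by positivity)
  have s3 : 0 ≤ (-v + 8 / 5) * (
      26367 / 10000 * (v ^ 2 + 781 / 1000 * u * v + 21 / 250 * u ^ 2 - 21 / 500 * v +
      23 / 1000 * u - 173 / 1000) ^ 2 +
      499 / 10000 * (u * v + 69 / 1000 * u ^ 2 - 59 / 1000 * v + 9 / 100 * u - 6 / 125) ^ 2 +
      21 / 1000 * (u ^ 2 + 1 / 250 * v + 17 / 500 * u - 7 / 500) ^ 2 +
      113 / 5000 * (v + 3 / 250 * u + 17 / 1000) ^ 2 +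
      217 / 10000 * (u + 13 / 1000) ^ 2 +
      53 / 2500) :=
    mul_nonneg h3.le (by positivity)
  rw [hX, hY]
  rw [h] at hl
  linarith [
    neg_monomial_le u v 0 1, monomial_le u v 0 2, monomial_le u v 0 3, neg_monomial_le u v 0 4,
    neg_monomial_le u v 0 5, neg_monomial_le u v 1 0, monomial_le u v 1 1, monomial_le u v 1 2,
    neg_monomial_le u v 1 3, monomial_le u v 1 4, monomial_le u v 1 5, neg_monomial_le u v 2 0,
    neg_monomial_le u v 2 1, neg_monomial_le u v 2 2, monomial_le u v 2 3,
    neg_monomial_le u v 2 4, neg_monomial_le u v 3 0, monomial_le u v 3 1, monomial_le u v 3 2,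
    monomial_le u v 3 3, monomial_le u v 4 0, neg_monomial_le u v 4 1, neg_monomial_le u v 4 2,
    monomial_le u v 5 0, monomial_le u v 5 1]

theorem radialDeriv_pos_north {x y : ℝ} (h0 : h x y = 0) (h1 : -2 / 5 < x) (h2 : 3 / 5 < y) :
    0 < (x - 37 / 20) * hX x y + (y - 11 / 5) * hY x y := by
  obtain ⟨u, rfl⟩ : ∃ u, x = 3 / 2 * u + 37 / 20 := ⟨(x - 37 / 20) / (3 / 2), by ring⟩
  obtain ⟨v, rfl⟩ : ∃ v, y = 3 / 2 * v + 11 / 5 := ⟨(y - 11 / 5) / (3 / 2), by ring⟩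
  have hl : (697 / 10 + 211 / 10 * u - 243 / 10 * v - 1457 / 5 * u ^ 2 + 590 * u * v -
      3907 / 10 * v ^ 2) * h (3 / 2 * u + 37 / 20) (3 / 2 * v + 11 / 5) = 0 := by
    rw [h0, mul_zero]
  replace h1 : 0 < u + 3 / 2 := by linarith
  replace h2 : 0 < v + 16 / 15 := by linarith
  have s0 : 0 ≤
      519590847 / 10000000 * (v ^ 3 - 928413 / 1000000 * u * v ^ 2 + 18519 / 250000 * u ^ 2 * v +
      42281 / 200000 * u ^ 3 + 368963 / 200000 * v ^ 2 - 1316129 / 500000 * u * v +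
      154587 / 125000 * u ^ 2 - 120987 / 1000000 * v - 104503 / 1000000 * u - 156043 / 500000) ^ 2 +
      11701873 / 2000000 * (u * v ^ 2 - 538021 / 500000 * u ^ 2 * v + 218003 / 500000 * u ^ 3 +
      83193 / 50000 * v ^ 2 - 2335263 / 1000000 * u * v + 1137101 / 1000000 * u ^ 2 -
      4553 / 1000000 * v - 24287 / 125000 * u - 76039 / 250000) ^ 2 +
      87716 / 78125 * (u ^ 2 * v - 160521 / 1000000 * u ^ 3 + 2581549 / 1000000 * v ^ 2 -
      1852961 / 500000 * u * v + 25773 / 12500 * u ^ 2 - 28419 / 500000 * v - 204247 / 500000 * u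
      - 599841 / 1000000) ^ 2 +
      1523287 / 10000000 * (u ^ 3 + 1934067 / 500000 * v ^ 2 - 3319601 / 500000 * u * v +
      1879579 / 500000 * u ^ 2 + 1413 / 15625 * v - 467439 / 500000 * u - 108207 / 125000) ^ 2 +
      17334703 / 10000000 * (v ^ 2 - 824177 / 500000 * u * v + 11541 / 15625 * u ^ 2 +
      32007 / 500000 * v - 117921 / 1000000 * u - 128017 / 1000000) ^ 2 +
      63733 / 250000 * (u * v - 855141 / 1000000 * u ^ 2 + 513921 / 1000000 * v -
      287137 / 1000000 * u + 87597 / 1000000) ^ 2 +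
      147299 / 5000000 * (u ^ 2 + 125457 / 1000000 * v + 180747 / 1000000 * u - 7818 / 15625) ^ 2 +
      9113 / 156250 * (v - 777443 / 1000000 * u + 36181 / 200000) ^ 2 +
      229349 / 10000000 * (u + 470211 / 1000000) ^ 2 := by
    positivity
  have s1 : 0 ≤ (u + 3 / 2) * (
      17775701 / 2500000 * (v ^ 2 - 1678929 / 1000000 * u * v + 836149 / 1000000 * u ^ 2 +
      6907 / 125000 * v - 13603 / 200000 * u - 78059 / 500000) ^ 2 +
      2377287 / 10000000 * (u * v - 858147 / 1000000 * u ^ 2 + 51921 / 200000 * v -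
      44969 / 1000000 * u + 8233 / 125000) ^ 2 +
      311069 / 10000000 * (u ^ 2 + 24441 / 500000 * v + 27993 / 125000 * u - 48683 / 100000) ^ 2 +
      309559 / 5000000 * (v - 820731 / 1000000 * u + 162977 / 1000000) ^ 2 +
      94223 / 10000000 * (u + 24417 / 50000) ^ 2 +
      11029 / 2000000) :=
    mul_nonneg h1.le (by positivity)
  have s2 : 0 ≤ (v + 16 / 15) * (
      491851637 / 10000000 * (v ^ 2 - 1571971 / 1000000 * u * v + 786339 / 1000000 * u ^ 2 +
      70667 / 1000000 * v - 11121 / 200000 * u - 45543 / 250000) ^ 2 +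
      3048043 / 10000000 * (u * v - 830673 / 1000000 * u ^ 2 + 271437 / 1000000 * v -
      33943 / 500000 * u + 14811 / 500000) ^ 2 +
      639007 / 10000000 * (u ^ 2 + 68193 / 200000 * v - 71957 / 1000000 * u -
      533803 / 1000000) ^ 2 +
      809967 / 10000000 * (v - 885573 / 1000000 * u + 50409 / 500000) ^ 2 +
      128621 / 10000000 * (u + 24031 / 40000) ^ 2 +
      1547 / 250000) :=
    mul_nonneg h2.le (by positivity)
  rw [hX, hY]
  rw [h] at hl
  linarith [
    monomial_le u v 0 1, monomial_le u v 0 2, neg_monomial_le u v 0 3, neg_monomial_le u v 0 4,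
    neg_monomial_le u v 0 5, monomial_le u v 1 0, neg_monomial_le u v 1 1,
    neg_monomial_le u v 1 2, monomial_le u v 1 3, monomial_le u v 1 4, neg_monomial_le u v 1 5,
    monomial_le u v 2 0, monomial_le u v 2 1, neg_monomial_le u v 2 2, monomial_le u v 2 3,
    monomial_le u v 2 4, neg_monomial_le u v 3 0, monomial_le u v 3 1, neg_monomial_le u v 3 2,
    neg_monomial_le u v 3 3, neg_monomial_le u v 4 0, monomial_le u v 4 1, monomial_le u v 4 2,
    neg_monomial_le u v 5 0, monomial_le u v 5 1]

theorem radialDeriv_pos_south {x y : ℝ} (h0 : h x y = 0) (h1 : -2 / 5 < x) (h2 : y < -2 / 25) :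
    0 < (x - 13 / 5) * hX x y + (y + 8 / 5) * hY x y := by
  obtain ⟨u, rfl⟩ : ∃ u, x = 2 * u + 13 / 5 := ⟨(x - 13 / 5) / 2, by ring⟩
  obtain ⟨v, rfl⟩ : ∃ v, y = 2 * v - 8 / 5 := ⟨(y + 8 / 5) / 2, by ring⟩
  have hl : (8969 / 100 + 1369 / 100 * u + 4243 / 100 * v - 1754 / 5 * u ^ 2 -
      101531 / 100 * u * v - 4923 / 5 * v ^ 2) * h (2 * u + 13 / 5) (2 * v - 8 / 5) = 0 := by
    rw [h0, mul_zero]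
  replace h1 : 0 < u + 3 / 2 := by linarith
  replace h2 : 0 < -v + 19 / 25 := by linarith
  have s0 : 0 ≤
      21305912803 / 100000000 * (v ^ 3 + 106957 / 312500 * u * v ^ 2 - 21357 / 100000 * u ^ 2 * v
      - 1552811 / 10000000 * u ^ 3 - 3497913 / 2000000 * v ^ 2 - 16893139 / 10000000 * u * v -
      5625763 / 10000000 * u ^ 2 - 24767 / 400000 * v + 549463 / 10000000 * u +
      308653 / 2000000) ^ 2 +
      345447553 / 10000000 * (u * v ^ 2 + 1615929 / 2000000 * u ^ 2 * v + 463197 / 2000000 * u ^ 3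
      + 2992259 / 2000000 * v ^ 2 + 14257271 / 10000000 * u * v + 29797 / 62500 * u ^ 2 +
      19419 / 1250000 * v - 346471 / 5000000 * u - 27149 / 200000) ^ 2 +
      35256739 / 50000000 * (u ^ 2 * v - 852981 / 2500000 * u ^ 3 - 15946797 / 2000000 * v ^ 2 -
      81473339 / 10000000 * u * v - 16787119 / 5000000 * u ^ 2 - 2710883 / 10000000 * v +
      2851697 / 10000000 * u + 9730027 / 10000000) ^ 2 +
      613619 / 50000000 * (u ^ 3 + 47562159 / 5000000 * v ^ 2 + 13638751 / 1250000 * u * v +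
      45070137 / 10000000 * u ^ 2 + 1900453 / 10000000 * v - 4576509 / 10000000 * u -
      86276 / 78125) ^ 2 +
      23097887 / 50000000 * (v ^ 2 + 9687477 / 10000000 * u * v + 17658 / 78125 * u ^ 2 -
      508981 / 10000000 * v - 42603 / 1000000 * u - 300271 / 10000000) ^ 2 +
      636241 / 25000000 * (u * v + 5342367 / 10000000 * u ^ 2 + 6243963 / 10000000 * v +
      133427 / 625000 * u - 380131 / 5000000) ^ 2 +
      142843 / 50000000 * (u ^ 2 + 922991 / 5000000 * v + 1117367 / 2000000 * u -
      38829 / 2500000) ^ 2 +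
      585551 / 100000000 * (v + 4592299 / 10000000 * u - 1204677 / 10000000) ^ 2 +
      100353 / 50000000 * (u + 616409 / 2000000) ^ 2 := by
    positivity
  have s1 : 0 ≤ (u + 3 / 2) * (
      3893385883 / 100000000 * (v ^ 2 + 827587 / 625000 * u * v + 4863407 / 10000000 * u ^ 2 +
      59527 / 5000000 * v - 128621 / 10000000 * u - 7807 / 100000) ^ 2 +
      8300641 / 100000000 * (u * v + 6881247 / 10000000 * u ^ 2 + 238927 / 1000000 * v +
      216489 / 2500000 * u - 7907 / 80000) ^ 2 +
      216179 / 100000000 * (u ^ 2 - 1539993 / 5000000 * v + 2140571 / 10000000 * u -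
      2294537 / 10000000) ^ 2 +
      423689 / 50000000 * (v + 1035709 / 2000000 * u - 355603 / 5000000) ^ 2 +
      33119 / 25000000 * (u + 392213 / 2000000) ^ 2 +
      12319 / 12500000) :=
    mul_nonneg h1.le (by positivity)
  have s2 : 0 ≤ (-v + 19 / 25) * (
      17998034983 / 100000000 * (v ^ 2 + 264483 / 250000 * u * v + 3717681 / 10000000 * u ^ 2 -
      270099 / 5000000 * v - 7093 / 500000 * u - 481481 / 5000000) ^ 2 +
      987861 / 20000000 * (u * v + 918949 / 1250000 * u ^ 2 + 3508499 / 10000000 * v +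
      1786129 / 10000000 * u - 1318029 / 10000000) ^ 2 +
      552077 / 50000000 * (u ^ 2 - 2655907 / 5000000 * v + 6377 / 100000 * u -
      310989 / 625000) ^ 2 +
      1354493 / 100000000 * (v + 1146149 / 2000000 * u - 30203 / 2000000) ^ 2 +
      19587 / 10000000 * (u + 816881 / 2000000) ^ 2 +
      71871 / 50000000) :=
    mul_nonneg h2.le (by positivity)
  rw [hX, hY]
  rw [h] at hl
  linarith [
    neg_monomial_le u v 0 1, monomial_le u v 0 2, monomial_le u v 0 3, neg_monomial_le u v 0 4,
    neg_monomial_le u v 0 5, monomial_le u v 1 0, neg_monomial_le u v 1 1, monomial_le u v 1 2,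
    monomial_le u v 1 3, neg_monomial_le u v 1 4, neg_monomial_le u v 1 5, monomial_le u v 2 0,
    neg_monomial_le u v 2 1, monomial_le u v 2 2, monomial_le u v 2 3, neg_monomial_le u v 2 4,
    neg_monomial_le u v 3 0, monomial_le u v 3 1, monomial_le u v 3 2, neg_monomial_le u v 3 3,
    neg_monomial_le u v 4 0, monomial_le u v 4 1, neg_monomial_le u v 4 2,
    neg_monomial_le u v 5 0, neg_monomial_le u v 5 1]

theorem h_pos_of_fst_eq {x : ℝ} (hx : x = -2 / 5) (y : ℝ) : 0 < h x y := by
  subst hx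
  rw [h]
  nlinarith [sq_nonneg (y ^ 2 - 652 / 1125 * y + 3659 / 50625), sq_nonneg (y - 7 / 40)]

theorem h_pos_of_snd_eq_neg {x y : ℝ} (hx : -2 / 5 ≤ x) (hy : y = -2 / 25) : 0 < h x y := by
  obtain ⟨u, rfl⟩ : ∃ u, x = u - 2 / 5 := ⟨x + 2 / 5, by ring⟩
  subst hy
  have hu : 0 ≤ u := by linarith
  rw [h]
  nlinarith [sq_nonneg (u ^ 2 - 29 / 25 * u + 39 / 100), sq_nonneg (u - 3 / 4),
    mul_nonneg hu (sq_nonneg (u - 4 / 5))]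

theorem h_pos_of_snd_eq_pos {x y : ℝ} (hx : -2 / 5 ≤ x) (hy : y = 3 / 5) : 0 < h x y := by
  obtain ⟨u, rfl⟩ : ∃ u, x = u - 2 / 5 := ⟨x + 2 / 5, by ring⟩
  subst hy
  have hu : 0 ≤ u := by linarith
  rw [h]
  nlinarith [sq_nonneg (u ^ 2 - 3 / 2 * u + 37 / 100), sq_nonneg (u - 3 / 4),
    mul_nonneg hu (sq_nonneg (u - 7 / 10))]

theorem sq_add_sq_le_h (x y : ℝ) : x ^ 2 + y ^ 2 - 1000000 ≤ h x y := by
  obtain ⟨u, rfl⟩ : ∃ u, x = 10 * u := ⟨x / 10, by ring⟩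
  obtain ⟨v, rfl⟩ : ∃ v, y = 10 * v := ⟨y / 10, by ring⟩
  rw [h]
  nlinarith [sq_nonneg (v ^ 2 - 13 / 75 * u * v - 2 / 15 * u ^ 2 - 73 / 1125 * v - 7 / 40 * u),
    sq_nonneg (u * v + 19 / 100 * u ^ 2 - 9 / 100 * v - 1 / 5),
    sq_nonneg (u ^ 2 + 11 / 100 * v + 12 / 100 * u - 3 / 5), sq_nonneg v, sq_nonneg u,
    sq_nonneg (u + v), sq_nonneg (u ^ 2), sq_nonneg (u - 1), sq_nonneg (u + 1)]

/-- The gradient of `h` at a point, as a continuous linear form. -/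
def hGrad (q : ℝ × ℝ) : ℝ × ℝ →L[ℝ] ℝ :=
  hX q.1 q.2 • ContinuousLinearMap.fst ℝ ℝ ℝ + hY q.1 q.2 • ContinuousLinearMap.snd ℝ ℝ ℝ

theorem hGrad_apply (q v : ℝ × ℝ) : hGrad q v = v.1 * hX q.1 q.2 + v.2 * hY q.1 q.2 := by
  simp [hGrad, mul_comm]

theorem hasFDerivAt_h (q : ℝ × ℝ) : HasFDerivAt (fun q : ℝ × ℝ => h q.1 q.2) (hGrad q) q := by
  have h1 : HasFDerivAt (fun q : ℝ × ℝ => q.1) (ContinuousLinearMap.fst ℝ ℝ ℝ) q := hasFDerivAt_fst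
  have h2 : HasFDerivAt (fun q : ℝ × ℝ => q.2) (ContinuousLinearMap.snd ℝ ℝ ℝ) q := hasFDerivAt_snd
  unfold h
  have key := ((((((((((((((hasFDerivAt_const (25 : ℝ) q).sub (h1.const_mul 134)).sub
    (h2.const_mul 374)).add ((h1.pow 2).const_mul 91)).add ((h1.const_mul 948).mul h2)).add
    ((h2.pow 2).const_mul 1137)).add ((h1.pow 3).const_mul 429)).add
    (((h1.pow 2).const_mul 612).mul h2)).sub ((h1.const_mul 2313).mul (h2.pow 2))).sub
    ((h2.pow 3).const_mul 876)).add ((h1.pow 4).const_mul 63)).add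
    (((h1.pow 3).const_mul 54).mul h2)).sub (((h1.pow 2).const_mul 99).mul (h2.pow 2))).sub
    ((h1.const_mul 234).mul (h2.pow 3))).add ((h2.pow 4).const_mul 675)
  refine key.congr_fderiv ?_
  ext <;> simp [hGrad, hX, hY] <;> ring

theorem deriv_h_fst (q : ℝ × ℝ) : deriv (fun t => h t q.2) q.1 = hX q.1 q.2 := by
  have hline : HasDerivAt (fun t : ℝ => (t, q.2)) (1, 0) q.1 :=
    (hasDerivAt_id q.1).prodMk (hasDerivAt_const q.1 q.2)
  have := HasFDerivAt.comp_hasDerivAt (f := fun t => (t, q.2)) q.1 (hasFDerivAt_h q) hline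
  simpa [hGrad_apply, Function.comp_def] using this.deriv

theorem deriv_h_snd (q : ℝ × ℝ) : deriv (fun t => h q.1 t) q.2 = hY q.1 q.2 := by
  have hline : HasDerivAt (fun t : ℝ => (q.1, t)) (0, 1) q.2 :=
    (hasDerivAt_const q.2 q.1).prodMk (hasDerivAt_id q.2)
  have := HasFDerivAt.comp_hasDerivAt (f := fun t => (q.1, t)) q.2 (hasFDerivAt_h q) hline
  simpa [hGrad_apply, Function.comp_def] using this.deriv

theorem continuous_h : Continuous fun q : ℝ × ℝ => h q.1 q.2 :=
  continuous_iff_continuousAt.2 fun q => (hasFDerivAt_h q).continuousAt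

theorem isBounded_h_nonpos : Bornology.IsBounded {q : ℝ × ℝ | h q.1 q.2 ≤ 0} := by
  refine (Metric.isBounded_closedBall (x := 0) (r := 1000)).subset fun q hq => ?_
  have hle := (sq_add_sq_le_h q.1 q.2).trans hq
  rw [mem_closedBall_zero_iff, Prod.norm_def, max_le_iff, Real.norm_eq_abs, Real.norm_eq_abs]
  exact ⟨abs_le_of_sq_le_sq (by nlinarith [sq_nonneg q.2]) (by norm_num),
    abs_le_of_sq_le_sq (by nlinarith [sq_nonneg q.1]) (by norm_num)⟩

theorem isCompact_h_zeros : IsCompact {q : ℝ × ℝ | h q.1 q.2 = 0} :=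
  Metric.isCompact_of_isClosed_isBounded (isClosed_eq continuous_h continuous_const)
    (isBounded_h_nonpos.subset fun _ hq => le_of_eq hq)

/-- Four disjoint open polygonal regions separating the ovals of the curve `h = 0`. -/
def region : Fin 4 → Set (ℝ × ℝ)
  | 0 => {q | q.1 < -2 / 5}
  | 1 => {q | -2 / 5 < q.1 ∧ -2 / 25 < q.2 ∧ q.2 < 3 / 5}
  | 2 => {q | -2 / 5 < q.1 ∧ 3 / 5 < q.2}
  | 3 => {q | -2 / 5 < q.1 ∧ q.2 < -2 / 25}

/-- A point inside the oval in each region. -/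
noncomputable def ovalCenter : Fin 4 → ℝ × ℝ
  | 0 => (-47 / 10, -3 / 20)
  | 1 => (1 / 10, 1 / 5)
  | 2 => (37 / 20, 11 / 5)
  | 3 => (13 / 5, -8 / 5)

theorem isOpen_region (i : Fin 4) : IsOpen (region i) := by
  have hl : ∀ c : ℝ, IsOpen {q : ℝ × ℝ | c < q.1} := fun c => isOpen_lt (by fun_prop) (by fun_prop)
  have hb : ∀ c : ℝ, IsOpen {q : ℝ × ℝ | c < q.2} := fun c => isOpen_lt (by fun_prop) (by fun_prop)
  have ht : ∀ c : ℝ, IsOpen {q : ℝ × ℝ | q.2 < c} := fun c => isOpen_lt (by fun_prop) (by fun_prop)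
  fin_cases i
  · exact isOpen_lt (by fun_prop) (by fun_prop)
  · exact (hl _).inter ((hb _).inter (ht _))
  · exact (hl _).inter (hb _)
  · exact (hl _).inter (ht _)

theorem convex_region (i : Fin 4) : Convex ℝ (region i) := by
  have hf : IsLinearMap ℝ (fun q : ℝ × ℝ => q.1) := (LinearMap.fst ℝ ℝ ℝ).isLinear
  have hs : IsLinearMap ℝ (fun q : ℝ × ℝ => q.2) := (LinearMap.snd ℝ ℝ ℝ).isLinear
  fin_cases i
  · exact convex_halfSpace_lt hf _
  · exact (convex_halfSpace_gt hf _).inter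
      ((convex_halfSpace_gt hs _).inter (convex_halfSpace_lt hs _))
  · exact (convex_halfSpace_gt hf _).inter (convex_halfSpace_gt hs _)
  · exact (convex_halfSpace_gt hf _).inter (convex_halfSpace_lt hs _)

theorem pairwise_disjoint_region : Pairwise (Function.onFun Disjoint region) := by
  intro i j hij
  refine disjoint_left.2 fun q hi hj => hij ?_
  fin_cases i <;> fin_cases j <;> simp only [region, mem_ofPred_eq] at hi hj ⊢ <;>
    exfalso <;> linarith

theorem ovalCenter_mem_region (i : Fin 4) : ovalCenter i ∈ region i := by
  fin_cases i <;> norm_num [ovalCenter, region]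

theorem h_ovalCenter_neg (i : Fin 4) : h (ovalCenter i).1 (ovalCenter i).2 < 0 := by
  fin_cases i <;> norm_num [ovalCenter, h]

theorem h_pos_of_mem_frontier_region (i : Fin 4) (q : ℝ × ℝ) (hq : q ∈ frontier (region i)) :
    0 < h q.1 q.2 := by
  rw [(isOpen_region i).frontier_eq] at hq
  obtain ⟨hcl, hnot⟩ := hq
  have hl : ∀ c : ℝ, IsClosed {q : ℝ × ℝ | c ≤ q.1} :=
    fun c => isClosed_le (by fun_prop) (by fun_prop)
  have hb : ∀ c : ℝ, IsClosed {q : ℝ × ℝ | c ≤ q.2} :=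
    fun c => isClosed_le (by fun_prop) (by fun_prop)
  have ht : ∀ c : ℝ, IsClosed {q : ℝ × ℝ | q.2 ≤ c} :=
    fun c => isClosed_le (by fun_prop) (by fun_prop)
  have hw : IsClosed {q : ℝ × ℝ | q.1 ≤ -2 / 5} := isClosed_le (by fun_prop) (by fun_prop)
  fin_cases i
  · have hsub : region 0 ⊆ {q | q.1 ≤ -2 / 5} := fun r (hr : r.1 < -2 / 5) => le_of_lt hr
    have h1 : q.1 ≤ -2 / 5 := closure_minimal hsub hw hcl
    exact h_pos_of_fst_eq (h1.antisymm (not_lt.1 hnot)) _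
  · have hsub : region 1 ⊆ {q | -2 / 5 ≤ q.1} ∩ ({q | -2 / 25 ≤ q.2} ∩ {q | q.2 ≤ 3 / 5}) :=
      fun r hr => ⟨le_of_lt hr.1, le_of_lt hr.2.1, le_of_lt hr.2.2⟩
    obtain ⟨h1, h2, h3⟩ : -2 / 5 ≤ q.1 ∧ -2 / 25 ≤ q.2 ∧ q.2 ≤ 3 / 5 :=
      closure_minimal hsub ((hl _).inter ((hb _).inter (ht _))) hcl
    rcases h1.eq_or_lt with h1' | h1'
    · exact h_pos_of_fst_eq h1'.symm _
    rcases h2.eq_or_lt with h2' | h2'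
    · exact h_pos_of_snd_eq_neg h1 h2'.symm
    · exact h_pos_of_snd_eq_pos h1 (h3.antisymm (not_lt.1 fun h3' => hnot ⟨h1', h2', h3'⟩))
  · have hsub : region 2 ⊆ {q | -2 / 5 ≤ q.1} ∩ {q | 3 / 5 ≤ q.2} :=
      fun r hr => ⟨le_of_lt hr.1, le_of_lt hr.2⟩
    obtain ⟨h1, h2⟩ : -2 / 5 ≤ q.1 ∧ 3 / 5 ≤ q.2 :=
      closure_minimal hsub ((hl _).inter (hb _)) hcl
    rcases h1.eq_or_lt with h1' | h1'
    · exact h_pos_of_fst_eq h1'.symm _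
    · exact h_pos_of_snd_eq_pos h1 (le_antisymm (not_lt.1 fun h2' => hnot ⟨h1', h2'⟩) h2)
  · have hsub : region 3 ⊆ {q | -2 / 5 ≤ q.1} ∩ {q | q.2 ≤ -2 / 25} :=
      fun r hr => ⟨le_of_lt hr.1, le_of_lt hr.2⟩
    obtain ⟨h1, h2⟩ : -2 / 5 ≤ q.1 ∧ q.2 ≤ -2 / 25 :=
      closure_minimal hsub ((hl _).inter (ht _)) hcl
    rcases h1.eq_or_lt with h1' | h1'
    · exact h_pos_of_fst_eq h1'.symm _
    · exact h_pos_of_snd_eq_neg h1 (h2.antisymm (not_lt.1 fun h2' => hnot ⟨h1', h2'⟩))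

theorem h_zeros_subset_iUnion_region : {q : ℝ × ℝ | h q.1 q.2 = 0} ⊆ ⋃ i, region i := by
  intro q hq
  rw [mem_iUnion]
  rcases lt_trichotomy q.1 (-2 / 5) with h1 | h1 | h1
  · exact ⟨0, h1⟩
  · exact absurd hq (h_pos_of_fst_eq h1 _).ne'
  rcases lt_trichotomy q.2 (-2 / 25) with h2 | h2 | h2
  · exact ⟨3, h1, h2⟩
  · exact absurd hq (h_pos_of_snd_eq_neg h1.le h2).ne'
  rcases lt_trichotomy q.2 (3 / 5) with h3 | h3 | h3
  · exact ⟨1, h1, h2, h3⟩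
  · exact absurd hq (h_pos_of_snd_eq_pos h1.le h3).ne'
  · exact ⟨2, h1, h3⟩

theorem hGrad_radial_pos (i : Fin 4) (q : ℝ × ℝ) (hq : q ∈ region i) (h0 : h q.1 q.2 = 0) :
    0 < hGrad q (q - ovalCenter i) := by
  rw [hGrad_apply]
  fin_cases i <;> simp only [ovalCenter, Prod.fst_sub, Prod.snd_sub]
  · convert radialDeriv_pos_west h0 hq using 3 <;> ring
  · exact radialDeriv_pos_middle h0 hq.1 hq.2.1 hq.2.2
  · exact radialDeriv_pos_north h0 hq.1 hq.2
  · convert radialDeriv_pos_south h0 hq.1 hq.2 using 3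
    ring

theorem isConnected_region_inter_h_zeros (i : Fin 4) :
    IsConnected (region i ∩ {q : ℝ × ℝ | h q.1 q.2 = 0}) :=
  isConnected_inter_zeros_of_radial (by rw [← Module.finrank_eq_rank]; norm_num) hasFDerivAt_h
    (isOpen_region i) (convex_region i) (ovalCenter_mem_region i) (h_ovalCenter_neg i)
    (h_pos_of_mem_frontier_region i) isBounded_h_nonpos isCompact_h_zeros (hGrad_radial_pos i)

/-- The zero set `Z = {(x,y) | h(x,y) = 0}` is compact, the gradient of `h` is
nonzero at every point of `Z`, and `Z` has exactly 4 connected components. -/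
theorem h_curve_four_ovals :
    IsCompact {p : ℝ × ℝ | h p.1 p.2 = 0} ∧
    (∀ p : ℝ × ℝ, h p.1 p.2 = 0 →
      (deriv (fun t => h t p.2) p.1, deriv (fun t => h p.1 t) p.2) ≠ (0, 0)) ∧
    (components {p : ℝ × ℝ | h p.1 p.2 = 0}).ncard = 4 := by
  refine ⟨isCompact_h_zeros, fun p hp hgrad => ?_, ?_⟩
  · obtain ⟨i, hi⟩ := mem_iUnion.1 (h_zeros_subset_iUnion_region hp)
    rw [deriv_h_fst, deriv_h_snd, Prod.mk.injEq] at hgrad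
    have := hGrad_radial_pos i p hi hp
    rw [hGrad_apply, hgrad.1, hgrad.2] at this
    simp at this
  · rw [ncard_components_of_open_cover isOpen_region pairwise_disjoint_region
      h_zeros_subset_iUnion_region isConnected_region_inter_h_zeros, Nat.card_fin]
end

section
/- Let h(x,y) = 25 − 134x − 374y + 91x² + 948xy + 1137y² + 429x³ + 612x²y − 2313xy² − 876y³ + 63x⁴ + 54x³y − 99x²y² − 234xy³ + 675y⁴. Then h is strictly positive on each of the three lines ℓ₁: y = 3/4 − x/2, ℓ₂: y = x/2 − 1/4, and ℓ₃: x = −2/5; that is, for all x ∈ ℝ, h(x, 3/4 − x/2) > 0 and h(x, x/2 − 1/4) > 0, and for all y ∈ ℝ, h(−2/5, y) > 0. -/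
/-- `h` is strictly positive on the lines `y = 3/4 - x/2`, `y = x/2 - 1/4`,
and `x = -2/5`. -/
theorem h_pos_on_lines :
    (∀ x : ℝ, 0 < h x (3 / 4 - x / 2)) ∧
    (∀ x : ℝ, 0 < h x (x / 2 - 1 / 4)) ∧
    (∀ y : ℝ, 0 < h (-2 / 5) y) := by
  refine ⟨fun x => ?_, fun x => ?_, fun y => ?_⟩ <;> unfold h
  · nlinarith [sq_nonneg (x ^ 2 - 1642 / 441 * x + 1), sq_nonneg (x - 1653897 / 4712599)]
  · nlinarith [sq_nonneg (x ^ 2 + 16 / 139 * x), sq_nonneg (x - 2416098 / 6551327)]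
  · nlinarith [sq_nonneg (y ^ 2 - 652 / 1125 * y), sq_nonneg (y - 617565 / 3411821)]
end
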